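/- Let n ≥ 1, let 0 < β < n be constant, let 1 < q₁ < n/β and define q₂ by 1/q₂ = 1/q₁ − β/n. Let 0 < p₁ ≤ p₂ < ∞, λ ≥ 0, and α > λ − n/q₂. Then there exists a constant C > 0 such that for every locally integrable function f on ℝⁿ one has ‖H*_β f‖_{MK̇^{α,λ}_{p₂,q₂}} ≤ C ‖f‖_{MK̇^{α,λ}_{p₁,q₁}}. (This is the constant-exponent, unweighted case of Theorem 3.2, i.e. the case γ(x) = 0 and β(x) ≡ β.) -/

import Mathlib

open MeasureTheory ENNReal

/-- The dyadic annulus `A_k = B_k \ B_{k-1} = {x : 2^(k-1) < ‖x‖ ≤ 2^k}` in `ℝⁿ`. -/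
def annulus (n : ℕ) (k : ℤ) : Set (EuclideanSpace ℝ (Fin n)) :=
  {x | (2 : ℝ) ^ (k - 1) < ‖x‖ ∧ ‖x‖ ≤ (2 : ℝ) ^ k}

/-- The homogeneous Herz–Morrey norm
`‖f‖_{MK̇^{α,λ}_{p,q}} = sup_{k₀∈ℤ} 2^{−k₀λ} (Σ_{k≤k₀} 2^{kαp} ‖f χ_k‖_{L^q}^p)^{1/p}`. -/
noncomputable def herzMorreyNorm (n : ℕ) (α lam p q : ℝ)
    (f : EuclideanSpace ℝ (Fin n) → ℝ) : ℝ≥0∞ :=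
  ⨆ k₀ : ℤ, (2 : ℝ≥0∞) ^ (-(k₀ : ℝ) * lam) *
    (∑' k : {k : ℤ // k ≤ k₀},
      (2 : ℝ≥0∞) ^ (((k : ℤ) : ℝ) * α * p) *
        eLpNorm ((annulus n k).indicator f) (ENNReal.ofReal q) volume ^ p) ^ (1 / p)

/-- The adjoint n-dimensional fractional Hardy operator
`H*_β f(x) = ∫_{|t|≥|x|} f(t) |t|^{β−n} dt`. -/
noncomputable def hardyOpAdj (n : ℕ) (β : ℝ) (f : EuclideanSpace ℝ (Fin n) → ℝ)
    (x : EuclideanSpace ℝ (Fin n)) : ℝ :=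
  ∫ t in {t : EuclideanSpace ℝ (Fin n) | ‖x‖ ≤ ‖t‖}, f t * ‖t‖ ^ (β - n)

theorem two_rpow_add (x y : ℝ) : (2 : ℝ≥0∞) ^ (x + y) = 2 ^ x * 2 ^ y :=
  ENNReal.rpow_add x y two_ne_zero ofNat_ne_top

theorem two_rpow_ne_top (x : ℝ) : (2 : ℝ≥0∞) ^ x ≠ ∞ :=
  ENNReal.rpow_ne_top_of_ne_zero two_ne_zero ofNat_ne_top

theorem tsum_two_rpow_neg_ne_top {c : ℝ} (hc : 0 < c) :
    ∑' m : ℕ, (2 : ℝ≥0∞) ^ (-(m : ℝ) * c) ≠ ∞ := by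
  have h : ∀ m : ℕ, (2 : ℝ≥0∞) ^ (-(m : ℝ) * c) = (2 ^ (-c)) ^ m := fun m ↦ by
    rw [← ENNReal.rpow_natCast, ← ENNReal.rpow_mul]
    congr 1
    ring
  simp_rw [h]
  rw [ENNReal.tsum_geometric, ENNReal.inv_ne_top, ne_eq, tsub_eq_zero_iff_le, not_le]
  exact ENNReal.rpow_lt_one_of_one_lt_of_neg one_lt_two (by linarith)

theorem tsum_rpow_le_rpow_tsum {ι : Type*} (x : ι → ℝ≥0∞) {r : ℝ} (hr : 1 ≤ r) :
    ∑' i, x i ^ r ≤ (∑' i, x i) ^ r := by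
  have key : ∀ y : ℝ≥0∞, y ^ r = y * y ^ (r - 1) := fun y ↦ by
    conv_lhs => rw [← add_sub_cancel 1 r]
    rw [ENNReal.rpow_add_of_nonneg _ _ zero_le_one (by linarith), ENNReal.rpow_one]
  rw [key, ← ENNReal.tsum_mul_right]
  refine ENNReal.tsum_le_tsum fun i ↦ ?_
  rw [key]
  gcongr
  exact ENNReal.le_tsum i

/-- The Morrey norm of a two-sided sequence, `sup_{k₀} 2^{−k₀λ} (Σ_{k≤k₀} a_k^p)^{1/p}`. -/
noncomputable def morreySeqNorm (lam p : ℝ) (a : ℤ → ℝ≥0∞) : ℝ≥0∞ :=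
  ⨆ k₀ : ℤ, (2 : ℝ≥0∞) ^ (-(k₀ : ℝ) * lam) * (∑' k : {k : ℤ // k ≤ k₀}, a k ^ p) ^ (1 / p)

theorem morreySeqNorm_le_iff {lam p : ℝ} (hp : 0 < p) {a : ℤ → ℝ≥0∞} {M : ℝ≥0∞} :
    morreySeqNorm lam p a ≤ M ↔
      ∀ k₀ : ℤ, ∑' k : {k : ℤ // k ≤ k₀}, a k ^ p ≤ (2 ^ ((k₀ : ℝ) * lam) * M) ^ p := by
  rw [morreySeqNorm, iSup_le_iff]
  refine forall_congr' fun k₀ ↦ ?_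
  rw [one_div, ← ENNReal.rpow_inv_le_iff hp, neg_mul, ENNReal.rpow_neg,
    ENNReal.inv_mul_le_iff (by simp) (two_rpow_ne_top _)]

theorem herzMorreyNorm_eq_morreySeqNorm (n : ℕ) {α lam p q : ℝ} (hp : 0 < p)
    (f : EuclideanSpace ℝ (Fin n) → ℝ) :
    herzMorreyNorm n α lam p q f = morreySeqNorm lam p fun k ↦
      2 ^ ((k : ℝ) * α) * eLpNorm ((annulus n k).indicator f) (ENNReal.ofReal q) volume := by
  simp_rw [herzMorreyNorm, morreySeqNorm, ENNReal.mul_rpow_of_nonneg _ _ hp.le, ENNReal.rpow_mul]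

theorem morreySeqNorm_antitone_exponent {lam p₁ p₂ : ℝ} (hp₁ : 0 < p₁) (hp₁₂ : p₁ ≤ p₂)
    (a : ℤ → ℝ≥0∞) : morreySeqNorm lam p₂ a ≤ morreySeqNorm lam p₁ a := by
  have hr : 1 ≤ p₂ / p₁ := (one_le_div hp₁).2 hp₁₂
  have hmul : p₁ * (p₂ / p₁) = p₂ := by field_simp
  refine (morreySeqNorm_le_iff (hp₁.trans_le hp₁₂)).2 fun k₀ ↦ ?_
  have h := (morreySeqNorm_le_iff (lam := lam) hp₁ (a := a)).1 le_rfl k₀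
  calc ∑' k : {k : ℤ // k ≤ k₀}, a k ^ p₂
      = ∑' k : {k : ℤ // k ≤ k₀}, (a k ^ p₁) ^ (p₂ / p₁) := by simp_rw [← ENNReal.rpow_mul, hmul]
    _ ≤ (∑' k : {k : ℤ // k ≤ k₀}, a k ^ p₁) ^ (p₂ / p₁) := tsum_rpow_le_rpow_tsum _ hr
    _ ≤ ((2 ^ ((k₀ : ℝ) * lam) * morreySeqNorm lam p₁ a) ^ p₁) ^ (p₂ / p₁) := by gcongr
    _ = _ := by rw [← ENNReal.rpow_mul, hmul]

theorem tsum_geometric_mul_le {ε d p : ℝ} (hp : 0 < p) (x : ℕ → ℝ≥0∞) :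
    ∑' m : ℕ, (2 : ℝ≥0∞) ^ (-(m : ℝ) * (d + ε)) * x m ≤
      (∑' m : ℕ, (2 : ℝ≥0∞) ^ (-(m : ℝ) * ε)) *
        (∑' m : ℕ, (2 ^ (-(m : ℝ) * d) * x m) ^ p) ^ (1 / p) := by
  rw [← ENNReal.tsum_mul_right]
  refine ENNReal.tsum_le_tsum fun m ↦ ?_
  rw [mul_add, add_comm, two_rpow_add, mul_assoc]
  gcongr
  rw [one_div, ENNReal.le_rpow_inv_iff hp]
  exact ENNReal.le_tsum (f := fun m : ℕ ↦ (2 ^ (-(m : ℝ) * d) * x m) ^ p) m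

/-- Hardy-type inequality for Morrey sequence norms. -/
theorem exists_morreySeqNorm_le {lam δ p : ℝ} (hp : 0 < p) (hδ : lam < δ) {K : ℝ≥0∞}
    (hK : K ≠ ∞) : ∃ C : ℝ≥0∞, C ≠ ∞ ∧ ∀ a b : ℤ → ℝ≥0∞,
      (∀ k : ℤ, b k ≤ K * ∑' m : ℕ, (2 : ℝ≥0∞) ^ (-(m : ℝ) * δ) * a (k + m)) →
        morreySeqNorm lam p b ≤ C * morreySeqNorm lam p a := by
  obtain ⟨ε, hε, rfl⟩ : ∃ ε, 0 < ε ∧ δ = lam + ε + ε :=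
    ⟨(δ - lam) / 2, by linarith, by ring⟩
  set G₁ := ∑' m : ℕ, (2 : ℝ≥0∞) ^ (-(m : ℝ) * ε)
  set G₂ := ∑' m : ℕ, (2 : ℝ≥0∞) ^ (-(m : ℝ) * (ε * p))
  have hG₁ : G₁ ≠ ∞ := tsum_two_rpow_neg_ne_top hε
  have hG₂ : G₂ ≠ ∞ := tsum_two_rpow_neg_ne_top (mul_pos hε hp)
  have hinv : ∀ y : ℝ≥0∞, (y ^ (1 / p)) ^ p = y := fun y ↦ by
    rw [← ENNReal.rpow_mul, one_div_mul_cancel hp.ne', ENNReal.rpow_one]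
  refine ⟨K * G₁ * G₂ ^ (1 / p), ENNReal.mul_ne_top (ENNReal.mul_ne_top hK hG₁)
    (ENNReal.rpow_ne_top_of_nonneg (by positivity) hG₂), fun a b hab ↦ ?_⟩
  set N := morreySeqNorm lam p a
  have hN := (morreySeqNorm_le_iff (lam := lam) hp (a := a) (M := N)).1 le_rfl
  have hb : ∀ k : ℤ, b k ^ p ≤
      (K * G₁) ^ p * ∑' m : ℕ, (2 ^ (-(m : ℝ) * (lam + ε)) * a (k + m)) ^ p := fun k ↦ by
    calc b k ^ p ≤ (K * (G₁ * (∑' m : ℕ,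
            (2 ^ (-(m : ℝ) * (lam + ε)) * a (k + m)) ^ p) ^ (1 / p))) ^ p := by
          gcongr
          exact (hab k).trans (by gcongr; exact tsum_geometric_mul_le hp fun m : ℕ ↦ a (k + m))
      _ = _ := by rw [← mul_assoc, ENNReal.mul_rpow_of_nonneg _ _ hp.le, hinv]
  refine (morreySeqNorm_le_iff hp).2 fun k₀ ↦ ?_
  have hshift : ∀ m : ℕ, ∑' k : {k : ℤ // k ≤ k₀}, a (k + m) ^ p ≤
      (2 ^ (((k₀ + m : ℤ) : ℝ) * lam) * N) ^ p := fun m ↦ by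
    refine le_trans ?_ (hN (k₀ + m))
    refine ENNReal.tsum_comp_le_tsum_of_injective
      (f := fun k : {k : ℤ // k ≤ k₀} ↦ (⟨k + m, by have := k.2; lia⟩ : {k : ℤ // k ≤ k₀ + m}))
      (fun k l h ↦ ?_) (fun k ↦ a k ^ p)
    simpa [Subtype.ext_iff] using h
  calc ∑' k : {k : ℤ // k ≤ k₀}, b k ^ p
      ≤ ∑' k : {k : ℤ // k ≤ k₀},
          (K * G₁) ^ p * ∑' m : ℕ, (2 ^ (-(m : ℝ) * (lam + ε)) * a (k + m)) ^ p :=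
        ENNReal.tsum_le_tsum fun k ↦ hb k
    _ = (K * G₁) ^ p * ∑' m : ℕ, (2 ^ (-(m : ℝ) * (lam + ε))) ^ p *
          ∑' k : {k : ℤ // k ≤ k₀}, a (k + m) ^ p := by
        rw [ENNReal.tsum_mul_left, ENNReal.tsum_comm]
        simp_rw [ENNReal.mul_rpow_of_nonneg _ _ hp.le, ENNReal.tsum_mul_left]
    _ ≤ (K * G₁) ^ p * ∑' m : ℕ, (2 ^ (-(m : ℝ) * (lam + ε))) ^ p *
          (2 ^ (((k₀ + m : ℤ) : ℝ) * lam) * N) ^ p := by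
        gcongr with m
        exact hshift m
    _ = (K * G₁) ^ p * (G₂ * (2 ^ ((k₀ : ℝ) * lam) * N) ^ p) := by
        rw [← ENNReal.tsum_mul_right]
        congr 2 with m
        have h : -(m : ℝ) * (lam + ε) + ((k₀ + m : ℤ) : ℝ) * lam = -m * ε + k₀ * lam := by
          push_cast
          ring
        rw [← ENNReal.mul_rpow_of_nonneg _ _ hp.le, ← mul_assoc, ← two_rpow_add, h, two_rpow_add,
          mul_assoc, ENNReal.mul_rpow_of_nonneg _ _ hp.le, ← ENNReal.rpow_mul, mul_assoc]
    _ = (2 ^ ((k₀ : ℝ) * lam) * (K * G₁ * G₂ ^ (1 / p) * N)) ^ p := by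
        simp_rw [ENNReal.mul_rpow_of_nonneg _ _ hp.le, hinv]
        ring

theorem measurableSet_annulus (n : ℕ) (k : ℤ) : MeasurableSet (annulus n k) :=
  (measurableSet_lt measurable_const measurable_norm).inter
    (measurableSet_le measurable_norm measurable_const)

theorem ofReal_two_zpow (k : ℤ) : ENNReal.ofReal ((2 : ℝ) ^ k) = 2 ^ (k : ℝ) := by
  rw [← Real.rpow_intCast, ← ENNReal.ofReal_rpow_of_pos two_pos, ENNReal.ofReal_ofNat]

theorem volume_annulus_le (n : ℕ) (k : ℤ) :
    volume (annulus n k) ≤ 2 ^ ((k : ℝ) * n) *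
      volume (Metric.ball (0 : EuclideanSpace ℝ (Fin n)) 1) := by
  have hsub : annulus n k ⊆ Metric.closedBall 0 ((2 : ℝ) ^ k) := fun x hx ↦ by
    simpa using hx.2
  refine (measure_mono hsub).trans_eq ?_
  rw [Measure.addHaar_closedBall _ _ (by positivity), finrank_euclideanSpace_fin,
    ENNReal.ofReal_pow (by positivity), ofReal_two_zpow, ENNReal.rpow_mul, ENNReal.rpow_natCast]

theorem volume_annulus_rpow_le (n : ℕ) (k : ℤ) {s : ℝ} (hs : 0 ≤ s) :
    volume (annulus n k) ^ s ≤ 2 ^ ((k : ℝ) * n * s) *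
      volume (Metric.ball (0 : EuclideanSpace ℝ (Fin n)) 1) ^ s := by
  rw [ENNReal.rpow_mul, ← ENNReal.mul_rpow_of_nonneg _ _ hs]
  gcongr
  exact volume_annulus_le n k

theorem enorm_norm_rpow_le_of_mem_annulus {n : ℕ} {j : ℤ} {s : ℝ} (hs : s ≤ 0)
    {t : EuclideanSpace ℝ (Fin n)} (ht : t ∈ annulus n j) :
    ‖‖t‖ ^ s‖ₑ ≤ 2 ^ (((j : ℝ) - 1) * s) := by
  have h : ‖t‖ ^ s ≤ ((2 : ℝ) ^ (j - 1)) ^ s :=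
    Real.rpow_le_rpow_of_nonpos (by positivity) ht.1.le hs
  rw [Real.enorm_of_nonneg (by positivity)]
  refine (ENNReal.ofReal_le_ofReal h).trans_eq ?_
  rw [← ENNReal.ofReal_rpow_of_pos (by positivity), ofReal_two_zpow, ← ENNReal.rpow_mul]
  push_cast
  rfl

theorem setLIntegral_annulus_enorm_mul_norm_rpow_le {n : ℕ} {β q : ℝ} (hβ : β ≤ n) (hq : 1 < q)
    {f : EuclideanSpace ℝ (Fin n) → ℝ} (hf : AEStronglyMeasurable f volume) (j : ℤ) :
    ∫⁻ t in annulus n j, ‖f t * ‖t‖ ^ (β - n)‖ₑ ≤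
      2 ^ (n - β) * volume (Metric.ball (0 : EuclideanSpace ℝ (Fin n)) 1) ^ (1 - 1 / q) *
        (2 ^ ((j : ℝ) * (β - n / q)) *
          eLpNorm ((annulus n j).indicator f) (ENNReal.ofReal q) volume) := by
  have hq0 : 0 < q := by linarith
  have hs : 0 ≤ 1 - 1 / q := by
    rw [sub_nonneg, div_le_one hq0]
    exact hq.le
  have holder : ∫⁻ t in annulus n j, ‖f t‖ₑ ≤
      eLpNorm ((annulus n j).indicator f) (ENNReal.ofReal q) volume *
        volume (annulus n j) ^ (1 - 1 / q) := by
    have h := eLpNorm_le_eLpNorm_mul_rpow_measure_univ (μ := volume.restrict (annulus n j))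
      (p := 1) (q := ENNReal.ofReal q) (by simpa using hq.le) hf.restrict
    rwa [eLpNorm_one_eq_lintegral_enorm, Measure.restrict_apply_univ, ENNReal.toReal_one, div_one,
      ENNReal.toReal_ofReal hq0.le,
      ← eLpNorm_indicator_eq_eLpNorm_restrict (measurableSet_annulus n j)] at h
  calc ∫⁻ t in annulus n j, ‖f t * ‖t‖ ^ (β - n)‖ₑ
      ≤ ∫⁻ t in annulus n j, 2 ^ (((j : ℝ) - 1) * (β - n)) * ‖f t‖ₑ := by
        refine setLIntegral_mono' (measurableSet_annulus n j) fun t ht ↦ ?_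
        rw [enorm_mul, mul_comm]
        gcongr
        exact enorm_norm_rpow_le_of_mem_annulus (by linarith) ht
    _ = 2 ^ (((j : ℝ) - 1) * (β - n)) * ∫⁻ t in annulus n j, ‖f t‖ₑ :=
        lintegral_const_mul' _ _ (two_rpow_ne_top _)
    _ ≤ 2 ^ (((j : ℝ) - 1) * (β - n)) *
          (eLpNorm ((annulus n j).indicator f) (ENNReal.ofReal q) volume *
            (2 ^ ((j : ℝ) * n * (1 - 1 / q)) *
              volume (Metric.ball (0 : EuclideanSpace ℝ (Fin n)) 1) ^ (1 - 1 / q))) := by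
        gcongr
        exact holder.trans (by gcongr; exact volume_annulus_rpow_le n j hs)
    _ = (2 ^ (((j : ℝ) - 1) * (β - n)) * 2 ^ ((j : ℝ) * n * (1 - 1 / q))) *
          (eLpNorm ((annulus n j).indicator f) (ENNReal.ofReal q) volume *
              volume (Metric.ball (0 : EuclideanSpace ℝ (Fin n)) 1) ^ (1 - 1 / q)) := by ring
    _ = (2 ^ (n - β) * 2 ^ ((j : ℝ) * (β - n / q))) *
          (eLpNorm ((annulus n j).indicator f) (ENNReal.ofReal q) volume *
              volume (Metric.ball (0 : EuclideanSpace ℝ (Fin n)) 1) ^ (1 - 1 / q)) := by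
        rw [← two_rpow_add, ← two_rpow_add]
        congr 2
        ring
    _ = _ := by ring

theorem subset_iUnion_annulus {n : ℕ} {k : ℤ} {x : EuclideanSpace ℝ (Fin n)}
    (hx : x ∈ annulus n k) : {t | ‖x‖ ≤ ‖t‖} ⊆ ⋃ m : ℕ, annulus n (k + m) := by
  intro t (ht : ‖x‖ ≤ ‖t‖)
  have hkt : (2 : ℝ) ^ (k - 1) < ‖t‖ := hx.1.trans_le ht
  obtain ⟨j, hj, hj'⟩ := _root_.exists_mem_Ioc_zpow
    ((by positivity : (0 : ℝ) < 2 ^ (k - 1)).trans hkt) (_root_.one_lt_two (α := ℝ))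
  have hkj : k - 1 < j + 1 := (zpow_lt_zpow_iff_right₀ _root_.one_lt_two).1 (hkt.trans_le hj')
  obtain ⟨m, hm⟩ := Int.le.dest (show k ≤ j + 1 by lia)
  refine Set.mem_iUnion.2 ⟨m, ?_, ?_⟩
  · rwa [hm, add_sub_cancel_right]
  · rwa [hm]

theorem enorm_hardyOpAdj_le_tsum {n : ℕ} (β : ℝ) (f : EuclideanSpace ℝ (Fin n) → ℝ) {k : ℤ}
    {x : EuclideanSpace ℝ (Fin n)} (hx : x ∈ annulus n k) :
    ‖hardyOpAdj n β f x‖ₑ ≤ ∑' m : ℕ, ∫⁻ t in annulus n (k + m), ‖f t * ‖t‖ ^ (β - n)‖ₑ :=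
  (enorm_integral_le_lintegral_enorm _).trans <|
    (lintegral_mono_set (subset_iUnion_annulus hx)).trans (lintegral_iUnion_le _ _)

theorem eLpNorm_indicator_annulus_le {n : ℕ} {q : ℝ} (hq : 0 < q) {k : ℤ}
    {g : EuclideanSpace ℝ (Fin n) → ℝ} {c : ℝ≥0∞} (hg : ∀ x ∈ annulus n k, ‖g x‖ₑ ≤ c) :
    eLpNorm ((annulus n k).indicator g) (ENNReal.ofReal q) volume ≤
      c * (2 ^ ((k : ℝ) * n * (1 / q)) *
        volume (Metric.ball (0 : EuclideanSpace ℝ (Fin n)) 1) ^ (1 / q)) := by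
  calc eLpNorm ((annulus n k).indicator g) (ENNReal.ofReal q) volume
      ≤ eLpNorm ((annulus n k).indicator fun _ ↦ c) (ENNReal.ofReal q) volume := by
        refine eLpNorm_mono_enorm fun x ↦ ?_
        by_cases hx : x ∈ annulus n k
        · simpa [hx] using hg x hx
        · simp [hx]
    _ ≤ c * volume (annulus n k) ^ (1 / q) := by
        simpa [ENNReal.toReal_ofReal hq.le] using
          eLpNorm_indicator_const_le (μ := volume) c (s := annulus n k) (ENNReal.ofReal q)
    _ ≤ _ := by
        gcongr
        exact volume_annulus_rpow_le n k (by positivity)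

theorem eLpNorm_indicator_annulus_hardyOpAdj_le {n : ℕ} {β q₁ q₂ : ℝ} (hβ : β ≤ n) (hq₁ : 1 < q₁)
    (hq₂ : 0 < q₂) (hβq : β - n / q₁ = -(n / q₂)) {f : EuclideanSpace ℝ (Fin n) → ℝ}
    (hf : AEStronglyMeasurable f volume) (α : ℝ) (k : ℤ) :
    2 ^ ((k : ℝ) * α) *
        eLpNorm ((annulus n k).indicator (hardyOpAdj n β f)) (ENNReal.ofReal q₂) volume ≤
      2 ^ (n - β) * volume (Metric.ball (0 : EuclideanSpace ℝ (Fin n)) 1) ^ (1 - 1 / q₁) *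
        volume (Metric.ball (0 : EuclideanSpace ℝ (Fin n)) 1) ^ (1 / q₂) *
        ∑' m : ℕ, 2 ^ (-(m : ℝ) * (α + n / q₂)) * (2 ^ (((k + m : ℤ) : ℝ) * α) *
          eLpNorm ((annulus n (k + m)).indicator f) (ENNReal.ofReal q₁) volume) := by
  set K := 2 ^ (n - β) * volume (Metric.ball (0 : EuclideanSpace ℝ (Fin n)) 1) ^ (1 - 1 / q₁)
  set V := volume (Metric.ball (0 : EuclideanSpace ℝ (Fin n)) 1) ^ (1 / q₂)
  set F : ℤ → ℝ≥0∞ := fun j ↦ eLpNorm ((annulus n j).indicator f) (ENNReal.ofReal q₁) volume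
  have hx : ∀ x ∈ annulus n k, ‖hardyOpAdj n β f x‖ₑ ≤
      K * ∑' m : ℕ, 2 ^ (((k + m : ℤ) : ℝ) * (-(n / q₂))) * F (k + m) := fun x hx ↦ by
    rw [← ENNReal.tsum_mul_left, ← hβq]
    exact (enorm_hardyOpAdj_le_tsum β f hx).trans <| ENNReal.tsum_le_tsum fun m ↦
      setLIntegral_annulus_enorm_mul_norm_rpow_le hβ hq₁ hf (k + m)
  calc 2 ^ ((k : ℝ) * α) *
        eLpNorm ((annulus n k).indicator (hardyOpAdj n β f)) (ENNReal.ofReal q₂) volume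
      ≤ 2 ^ ((k : ℝ) * α) * (K * (∑' m : ℕ, 2 ^ (((k + m : ℤ) : ℝ) * (-(n / q₂))) * F (k + m)) *
          (2 ^ ((k : ℝ) * n * (1 / q₂)) * V)) := by
        gcongr
        exact eLpNorm_indicator_annulus_le hq₂ hx
    _ = K * V * (2 ^ ((k : ℝ) * α + (k : ℝ) * n * (1 / q₂)) *
          ∑' m : ℕ, 2 ^ (((k + m : ℤ) : ℝ) * (-(n / q₂))) * F (k + m)) := by
        rw [two_rpow_add]
        ring
    _ = _ := by
        rw [← ENNReal.tsum_mul_left]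
        congr 2 with m
        rw [← mul_assoc, ← mul_assoc, ← two_rpow_add, ← two_rpow_add]
        congr 2
        push_cast
        ring

/-- The constant-exponent, unweighted case of Theorem 3.2: boundedness of the adjoint
fractional Hardy operator `H*_β` from `MK̇^{α,λ}_{p₁,q₁}` to `MK̇^{α,λ}_{p₂,q₂}`. -/
theorem fractionalHardyAdj_herzMorrey_bound
    (n : ℕ) (hn : 1 ≤ n) (β q₁ q₂ p₁ p₂ lam α : ℝ)
    (hβ0 : 0 < β) (hβn : β < n)
    (hq₁ : 1 < q₁) (hq₁' : q₁ < n / β)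
    (hq₂ : 1 / q₂ = 1 / q₁ - β / n)
    (hp₁ : 0 < p₁) (hp₁₂ : p₁ ≤ p₂)
    (hlam : 0 ≤ lam)
    (hα : lam - n / q₂ < α) :
    ∃ C : ℝ, 0 < C ∧
      ∀ f : EuclideanSpace ℝ (Fin n) → ℝ, LocallyIntegrable f volume →
        herzMorreyNorm n α lam p₂ q₂ (hardyOpAdj n β f) ≤
          ENNReal.ofReal C * herzMorreyNorm n α lam p₁ q₁ f := by
  have hn0 : (0 : ℝ) < n := hβ0.trans hβn
  have hq₁0 : 0 < q₁ := by linarith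
  have hq₂0 : 0 < q₂ := by
    rw [← one_div_pos, hq₂, sub_pos, div_lt_div_iff₀ hn0 hq₁0, one_mul, mul_comm]
    exact (lt_div_iff₀ hβ0).1 hq₁'
  have hβq : β - n / q₁ = -(n / q₂) := by
    rw [div_eq_mul_one_div (n : ℝ) q₂, hq₂]
    field_simp
    ring
  have hV : volume (Metric.ball (0 : EuclideanSpace ℝ (Fin n)) 1) ≠ ∞ :=
    measure_ball_lt_top.ne
  have hs : 0 ≤ 1 - 1 / q₁ := by
    rw [sub_nonneg, div_le_one hq₁0]
    exact hq₁.le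
  obtain ⟨C, hC, hle⟩ := exists_morreySeqNorm_le (lam := lam) (δ := α + n / q₂)
    (hp₁.trans_le hp₁₂) (by linarith)
    (ENNReal.mul_ne_top (ENNReal.mul_ne_top (two_rpow_ne_top (n - β))
      (ENNReal.rpow_ne_top_of_nonneg hs hV))
      (ENNReal.rpow_ne_top_of_nonneg (one_div_nonneg.2 hq₂0.le) hV))
  refine ⟨C.toReal + 1, by positivity, fun f hf ↦ ?_⟩
  have hC' : C ≤ ENNReal.ofReal (C.toReal + 1) := by
    rw [ENNReal.le_ofReal_iff_toReal_le hC (by positivity)]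
    linarith
  rw [herzMorreyNorm_eq_morreySeqNorm n (hp₁.trans_le hp₁₂),
    herzMorreyNorm_eq_morreySeqNorm n hp₁]
  refine (hle (fun j ↦ 2 ^ ((j : ℝ) * α) *
    eLpNorm ((annulus n j).indicator f) (ENNReal.ofReal q₁) volume) _ fun k ↦
      eLpNorm_indicator_annulus_hardyOpAdj_le hβn.le hq₁ hq₂0 hβq hf.aestronglyMeasurable α k).trans ?_
  gcongr
  exact morreySeqNorm_antitone_exponent hp₁ hp₁₂ _
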